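/- arXiv:1611.08175 — 2 statements merged into one kernel-verified Lean document; each statement's English description precedes it below -/
import Mathlib

section
/- Let P and Q be positive joint distributions on 𝒳 × 𝒴, let 0 < r < E(Q‖P), set F(r) = min{ D(Q̄‖Q) : Q̄ a joint distribution with E(Q̄‖P) ≤ r } and λ = −r + F(r). Then there exists exactly one pair (Q^λ, P^λ) of positive joint distributions with Q^λ ∈ ℰ^{xy}(Q) and P^λ ∈ ℰ^{xy}(P) satisfying: (i) there exist a ∈ ℝ∖{0} and b ∈ ℝ with log(P^λ(x,y)/P(x,y)) = a·log(Q^λ(x,y)/Q(x,y)) + b for all (x,y); (ii) D(Q^λ‖Q) − D(P^λ‖P) = λ; (iii) P^λ_X = Q^λ_X and P^λ_Y = Q^λ_Y; (iv) Σ_{x,y} Q(x,y)·Λ_λ(x,y) < λ < Σ_{x,y} P(x,y)·Λ_λ(x,y), where Λ_λ(x,y) := log(Q^λ(x,y)/Q(x,y)) − log(P^λ(x,y)/P(x,y)). Moreover this pair attains the optimum: E(Q^λ‖P) = D(P^λ‖P) = r and E(P^λ‖Q) = D(Q^λ‖Q) = F(r). -/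
open scoped Classical BigOperators

noncomputable section

variable {X Y : Type*} [Fintype X] [Fintype Y]

/-- `P` is a joint distribution on `X × Y`. -/
def IsDist (P : X × Y → ℝ) : Prop :=
  (∀ z, 0 ≤ P z) ∧ ∑ z : X × Y, P z = 1

/-- `P` is a positive joint distribution on `X × Y`. -/
def IsPos (P : X × Y → ℝ) : Prop :=
  (∀ z, 0 < P z) ∧ ∑ z : X × Y, P z = 1

/-- The first marginal of a joint distribution. -/
def margX (P : X × Y → ℝ) (x : X) : ℝ := ∑ y : Y, P (x, y)

/-- The second marginal of a joint distribution. -/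
def margY (P : X × Y → ℝ) (y : Y) : ℝ := ∑ x : X, P (x, y)

/-- Relative entropy `D(P‖Q)` (natural log; `Real.log 0 = 0` realizes `0·log 0 = 0`). -/
def relEnt (P Q : X × Y → ℝ) : ℝ := ∑ z : X × Y, P z * Real.log (P z / Q z)

/-- Projected relative entropy `E(P‖Q)`. -/
def projE (P Q : X × Y → ℝ) : ℝ :=
  sInf { d : ℝ | ∃ P' : X × Y → ℝ,
    IsDist P' ∧ margX P' = margX P ∧ margY P' = margY P ∧ d = relEnt P' Q }

/-- `R ∈ ℰ^{xy}(S)` : `R` has the same correlation coordinates as `S`. -/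
def SameCorr (R S : X × Y → ℝ) : Prop :=
  ∃ a1 : X → ℝ, ∃ a2 : Y → ℝ,
    ∀ x : X, ∀ y : Y, Real.log (R (x, y) / S (x, y)) = a1 x + a2 y

/-- The type (empirical distribution) of a sequence. -/
def empDist {n : ℕ} (x : Fin n → X) (a : X) : ℝ :=
  ((Finset.univ.filter fun i => x i = a).card : ℝ) / n

/-- The joint type of a pair of sequences. -/
def empJoint {n : ℕ} (x : Fin n → X) (y : Fin n → Y) (z : X × Y) : ℝ :=
  ((Finset.univ.filter fun i => x i = z.1 ∧ y i = z.2).card : ℝ) / n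

/-- Probability of a set under the `n`-fold i.i.d. product of `P`. -/
def prodProb (P : X × Y → ℝ) (n : ℕ) (A : Set ((Fin n → X) × (Fin n → Y))) : ℝ :=
  ∑ z : (Fin n → X) × (Fin n → Y),
    if z ∈ A then ∏ i : Fin n, P (z.1 i, z.2 i) else 0

/-- `P` is a joint type with denominator `n` (an element of `𝒫ₙ(𝒳 × 𝒴)`). -/
def IsTypeN (n : ℕ) (P : X × Y → ℝ) : Prop :=
  IsDist P ∧ ∀ z : X × Y, ∃ k : ℕ, P z = (k : ℝ) / n

/-- `Eₙ(P̄‖Q)` : projected relative entropy restricted to joint types. -/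
def En (n : ℕ) (Pbar Q : X × Y → ℝ) : ℝ :=
  sInf { d : ℝ | ∃ Pt : X × Y → ℝ,
    IsTypeN n Pt ∧ margX Pt = margX Pbar ∧ margY Pt = margY Pbar ∧ d = relEnt Pt Q }

/-- Standard normal cumulative distribution function `Φ`. -/
def stdNormalCDF (t : ℝ) : ℝ :=
  ∫ u in Set.Iic t, (Real.sqrt (2 * Real.pi))⁻¹ * Real.exp (-(u ^ 2) / 2)

/-- Inverse of the standard normal CDF, `Φ⁻¹`. -/
def stdNormalCDFInv (e : ℝ) : ℝ := Function.invFun stdNormalCDF e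

/-- The conditions (i)-(iv) on the pair `(Qλ, Pλ)` from the structure theorem,
together with positivity and membership in the respective exponential families. -/
def NPpair (P Q : X × Y → ℝ) (lam : ℝ) (Ql Pl : X × Y → ℝ) : Prop :=
  IsPos Ql ∧ IsPos Pl ∧ SameCorr Ql Q ∧ SameCorr Pl P ∧
  (∃ a b : ℝ, a ≠ 0 ∧
    ∀ z : X × Y, Real.log (Pl z / P z) = a * Real.log (Ql z / Q z) + b) ∧
  (relEnt Ql Q - relEnt Pl P = lam) ∧
  (margX Pl = margX Ql) ∧ (margY Pl = margY Ql) ∧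
  ((∑ z : X × Y, Q z * (Real.log (Ql z / Q z) - Real.log (Pl z / P z))) < lam) ∧
  (lam < ∑ z : X × Y, P z * (Real.log (Ql z / Q z) - Real.log (Pl z / P z)))

lemma IsPos.isDist {P : X × Y → ℝ} (h : IsPos P) : IsDist P := ⟨fun z => (h.1 z).le, h.2⟩

/-! ### Elementary properties of relative entropy -/

lemma relEnt_eq_sum_klFun {q R : X × Y → ℝ} (hq : IsDist q) (hR : IsPos R) :
    relEnt q R = ∑ z, R z * InformationTheory.klFun (q z / R z) := by
  have h : ∀ z, R z * InformationTheory.klFun (q z / R z)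
      = q z * Real.log (q z / R z) + R z - q z := by
    intro z
    have := (hR.1 z).ne'
    rw [InformationTheory.klFun_apply]
    field_simp
  simp_rw [h]
  rw [Finset.sum_sub_distrib, Finset.sum_add_distrib, hR.2, hq.2, relEnt]
  ring

lemma relEnt_nonneg {q R : X × Y → ℝ} (hq : IsDist q) (hR : IsPos R) : 0 ≤ relEnt q R := by
  rw [relEnt_eq_sum_klFun hq hR]
  exact Finset.sum_nonneg fun z _ => mul_nonneg (hR.1 z).le
    (InformationTheory.klFun_nonneg (div_nonneg (hq.1 z) (hR.1 z).le))

lemma eq_of_relEnt_eq_zero {q R : X × Y → ℝ} (hq : IsDist q) (hR : IsPos R)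
    (h : relEnt q R = 0) : q = R := by
  rw [relEnt_eq_sum_klFun hq hR, Finset.sum_eq_zero_iff_of_nonneg] at h
  · funext z
    have h1 := (mul_eq_zero.1 (h z (Finset.mem_univ z))).resolve_left (hR.1 z).ne'
    rw [InformationTheory.klFun_eq_zero_iff (div_nonneg (hq.1 z) (hR.1 z).le)] at h1
    exact (div_eq_one_iff_eq (hR.1 z).ne').1 h1
  · exact fun z _ => mul_nonneg (hR.1 z).le
      (InformationTheory.klFun_nonneg (div_nonneg (hq.1 z) (hR.1 z).le))

lemma relEnt_self {R : X × Y → ℝ} (hR : IsPos R) : relEnt R R = 0 := by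
  simp [div_self (hR.1 _).ne', relEnt]

/-- Chain rule for a change of reference measure. -/
lemma relEnt_eq_add_sum {q R S : X × Y → ℝ} (hR : IsPos R) (hS : IsPos S) :
    relEnt q S = relEnt q R + ∑ z, q z * Real.log (R z / S z) := by
  simp only [relEnt]
  rw [← Finset.sum_add_distrib]
  refine Finset.sum_congr rfl fun z _ => ?_
  rcases eq_or_ne (q z) 0 with h | h
  · simp [h]
  · rw [Real.log_div h (hS.1 z).ne', Real.log_div h (hR.1 z).ne',
      Real.log_div (hR.1 z).ne' (hS.1 z).ne']
    ring

lemma sum_mul_log_div_nonpos {R S : X × Y → ℝ} (hR : IsPos R) (hS : IsPos S) :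
    ∑ z, S z * Real.log (R z / S z) ≤ 0 := by
  have h := relEnt_eq_add_sum (q := S) hR hS
  rw [relEnt_self hS] at h
  linarith [relEnt_nonneg hS.isDist hR]

lemma continuous_relEnt {R : X × Y → ℝ} (hR : IsPos R) : Continuous fun q => relEnt q R := by
  have h : (fun q => relEnt q R)
      = fun q : X × Y → ℝ => ∑ z, R z * ((q z / R z) * Real.log (q z / R z)) := by
    funext q
    refine Finset.sum_congr rfl fun z _ => ?_
    have := (hR.1 z).ne'
    field_simp
  rw [h]
  refine continuous_finsetSum _ fun z _ => continuous_const.mul ?_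
  exact Real.continuous_mul_log.comp ((continuous_apply z).div_const _)

lemma mul_log_div_mix_le {R q w t : ℝ} (hR : 0 < R) (hq : 0 ≤ q) (hw : 0 ≤ w)
    (ht0 : 0 ≤ t) (ht1 : t ≤ 1) :
    ((1 - t) * q + t * w) * Real.log (((1 - t) * q + t * w) / R)
      ≤ (1 - t) * (q * Real.log (q / R)) + t * (w * Real.log (w / R)) := by
  have h := Real.convexOn_mul_log.2 (x := q / R) (div_nonneg hq hR.le) (y := w / R)
    (div_nonneg hw hR.le) (sub_nonneg.2 ht1) ht0 (by ring)
  simp only [smul_eq_mul] at h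
  have e : ((1 - t) * q + t * w) / R = (1 - t) * (q / R) + t * (w / R) := by ring
  rw [e]
  have h2 := mul_le_mul_of_nonneg_left h hR.le
  have hR' := hR.ne'
  calc _ = R * (((1 - t) * (q / R) + t * (w / R)) *
        Real.log ((1 - t) * (q / R) + t * (w / R))) := by field_simp
    _ ≤ _ := h2
    _ = _ := by field_simp

/-- The mixture `(1 - t) q + t w`. -/
def mix (t : ℝ) (q w : X × Y → ℝ) : X × Y → ℝ := fun z => (1 - t) * q z + t * w z

lemma relEnt_mix_le {q w R : X × Y → ℝ} {t : ℝ} (hq : IsDist q) (hw : IsDist w) (hR : IsPos R)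
    (ht0 : 0 ≤ t) (ht1 : t ≤ 1) :
    relEnt (mix t q w) R ≤ (1 - t) * relEnt q R + t * relEnt w R := by
  simp only [relEnt, Finset.mul_sum]
  rw [← Finset.sum_add_distrib]
  exact Finset.sum_le_sum fun z _ => mul_log_div_mix_le (hR.1 z) (hq.1 z) (hw.1 z) ht0 ht1

/-- At a zero of `q`, mixing in positive mass gains a term of order `t log t`. -/
lemma relEnt_mix_le_of_eq_zero {q w R : X × Y → ℝ} {t : ℝ} (hq : IsDist q) (hw : IsPos w)
    (hR : IsPos R) (ht0 : 0 < t) (ht1 : t ≤ 1) {z₀ : X × Y} (hz₀ : q z₀ = 0) :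
    relEnt (mix t q w) R
      ≤ (1 - t) * relEnt q R + t * relEnt w R + t * (w z₀ * Real.log t) := by
  have e : t * (w z₀ * Real.log t) = ∑ z, if z = z₀ then t * (w z₀ * Real.log t) else 0 := by
    simp
  rw [e]
  simp only [relEnt, Finset.mul_sum]
  rw [← Finset.sum_add_distrib, ← Finset.sum_add_distrib]
  refine Finset.sum_le_sum fun z _ => ?_
  split_ifs with h
  · subst h
    have := hw.1 z
    have := hR.1 z
    have e2 : t * w z / R z = t * (w z / R z) := by ring
    simp only [mix, hz₀, mul_zero, zero_add, zero_mul]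
    rw [e2, Real.log_mul ht0.ne' (by positivity)]
    apply le_of_eq
    ring
  · rw [add_zero]
    exact mul_log_div_mix_le (hR.1 z) (hq.1 z) (hw.1 z).le ht0.le ht1

lemma hasDerivAt_relEnt_line {q R δ : X × Y → ℝ} (hq : ∀ z, 0 < q z) (hR : IsPos R)
    (hδ : ∑ z, δ z = 0) :
    HasDerivAt (fun t : ℝ => relEnt (fun z => q z + t * δ z) R)
      (∑ z, δ z * Real.log (q z / R z)) 0 := by
  have key : HasDerivAt (fun t : ℝ => relEnt (fun z => q z + t * δ z) R)
      (∑ z, (δ z * Real.log (q z / R z) + δ z)) 0 := by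
    simp only [relEnt]
    refine HasDerivAt.fun_sum fun z _ => ?_
    have hq' := (hq z).ne'
    have hR' := (hR.1 z).ne'
    have h1 : HasDerivAt (fun t : ℝ => q z + t * δ z) (δ z) 0 := by
      simpa using ((hasDerivAt_id (0 : ℝ)).mul_const (δ z)).const_add (q z)
    have h2 := h1.fun_mul ((h1.div_const (R z)).log (by simp [hq', hR']))
    refine h2.congr_deriv ?_
    simp only [zero_mul, add_zero]
    field_simp
  rwa [Finset.sum_add_distrib, hδ, add_zero] at key

/-! ### Marginals and correlation coordinates -/

lemma sum_mul_add_eq_marg (q : X × Y → ℝ) (a₁ : X → ℝ) (a₂ : Y → ℝ) :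
    ∑ z, q z * (a₁ z.1 + a₂ z.2) = ∑ x, margX q x * a₁ x + ∑ y, margY q y * a₂ y := by
  simp only [mul_add, Finset.sum_add_distrib, margX, margY, Finset.sum_mul]
  rw [Fintype.sum_prod_type, Fintype.sum_prod_type_right]

lemma sum_mul_log_eq_of_sameCorr {R S p q : X × Y → ℝ} (h : SameCorr R S)
    (hX : margX p = margX q) (hY : margY p = margY q) :
    ∑ z, p z * Real.log (R z / S z) = ∑ z, q z * Real.log (R z / S z) := by
  obtain ⟨a₁, a₂, h⟩ := h
  have h' : ∀ z : X × Y, Real.log (R z / S z) = a₁ z.1 + a₂ z.2 := fun z => h z.1 z.2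
  simp only [h', sum_mul_add_eq_marg, hX, hY]

/-- Pythagorean identity for the family with fixed correlation coordinates. -/
lemma relEnt_pythagoras {R S p : X × Y → ℝ} (hR : IsPos R) (hS : IsPos S) (h : SameCorr R S)
    (hX : margX p = margX R) (hY : margY p = margY R) :
    relEnt p S = relEnt p R + relEnt R S := by
  rw [relEnt_eq_add_sum hR hS, sum_mul_log_eq_of_sameCorr h hX hY]
  rfl

lemma projE_eq_of_sameCorr {R S q : X × Y → ℝ} (hR : IsPos R) (hS : IsPos S) (h : SameCorr R S)
    (hX : margX R = margX q) (hY : margY R = margY q) : projE q S = relEnt R S := by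
  refine IsLeast.csInf_eq ⟨⟨R, hR.isDist, hX, hY, rfl⟩, ?_⟩
  rintro d ⟨p, hp, hpX, hpY, rfl⟩
  rw [relEnt_pythagoras hR hS h (hpX.trans hX.symm) (hpY.trans hY.symm)]
  linarith [relEnt_nonneg hp hR]

/-- Two joint distributions with the same marginals. -/
def Coupled (q p : X × Y → ℝ) : Prop :=
  IsDist q ∧ IsDist p ∧ margX p = margX q ∧ margY p = margY q

lemma Coupled.mix {q p q' p' : X × Y → ℝ} {t : ℝ} (h : Coupled q p) (h' : Coupled q' p')
    (ht0 : 0 ≤ t) (ht1 : t ≤ 1) : Coupled (mix t q q') (mix t p p') := by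
  obtain ⟨hq, hp, hX, hY⟩ := h
  obtain ⟨hq', hp', hX', hY'⟩ := h'
  have key : ∀ {a b : X × Y → ℝ}, IsDist a → IsDist b → IsDist (_root_.mix t a b) := by
    intro a b ha hb
    refine ⟨fun z => add_nonneg (mul_nonneg (sub_nonneg.2 ht1) (ha.1 z))
      (mul_nonneg ht0 (hb.1 z)), ?_⟩
    simp only [_root_.mix, Finset.sum_add_distrib, ← Finset.mul_sum, ha.2, hb.2]
    ring
  refine ⟨key hq hq', key hp hp', ?_, ?_⟩
  · funext x
    have h1 := congrFun hX x
    have h2 := congrFun hX' x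
    simp only [margX, _root_.mix, Finset.sum_add_distrib, ← Finset.mul_sum] at *
    rw [h1, h2]
  · funext y
    have h1 := congrFun hY y
    have h2 := congrFun hY' y
    simp only [margY, _root_.mix, Finset.sum_add_distrib, ← Finset.mul_sum] at *
    rw [h1, h2]

lemma isCompact_setOf_isDist : IsCompact {q : X × Y → ℝ | IsDist q} :=
  isCompact_stdSimplex ℝ (X × Y)

lemma continuous_margX {α β : Type*} [Fintype β] :
    Continuous (margX : (α × β → ℝ) → α → ℝ) := by
  unfold margX; fun_prop

lemma continuous_margY {α β : Type*} [Fintype α] :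
    Continuous (margY : (α × β → ℝ) → β → ℝ) := by
  unfold margY; fun_prop

lemma isCompact_setOf_coupled :
    IsCompact {w : (X × Y → ℝ) × (X × Y → ℝ) | Coupled w.1 w.2} := by
  have h := (isCompact_setOf_isDist (X := X) (Y := Y)).prod
    (isCompact_setOf_isDist (X := X) (Y := Y))
  have h1 : IsClosed {w : (X × Y → ℝ) × (X × Y → ℝ) | margX w.2 = margX w.1} :=
    isClosed_eq (continuous_margX.comp continuous_snd) (continuous_margX.comp continuous_fst)
  have h2 : IsClosed {w : (X × Y → ℝ) × (X × Y → ℝ) | margY w.2 = margY w.1} :=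
    isClosed_eq (continuous_margY.comp continuous_snd) (continuous_margY.comp continuous_fst)
  convert h.inter_right (h1.inter h2) using 1
  ext w
  simp [Coupled, and_assoc]

/-- The minimum defining the projected relative entropy is attained. -/
lemma exists_relEnt_eq_projE {q R : X × Y → ℝ} (hq : IsDist q) (hR : IsPos R) :
    ∃ p, Coupled q p ∧ relEnt p R = projE q R := by
  have hc : IsCompact {p : X × Y → ℝ | IsDist p ∧ margX p = margX q ∧ margY p = margY q} :=
    isCompact_setOf_isDist.inter_right
      ((isClosed_eq continuous_margX continuous_const).inter
        (isClosed_eq continuous_margY continuous_const))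
  obtain ⟨p, ⟨hp, hX, hY⟩, hmin⟩ :=
    hc.exists_isMinOn ⟨q, hq, rfl, rfl⟩ (continuous_relEnt hR).continuousOn
  refine ⟨p, ⟨hq, hp, hX, hY⟩, Eq.symm ?_⟩
  refine IsLeast.csInf_eq ⟨⟨p, hp, hX, hY, rfl⟩, ?_⟩
  rintro d ⟨p', hp', hX', hY', rfl⟩
  have hmem : p' ∈ {p : X × Y → ℝ | IsDist p ∧ margX p = margX q ∧ margY p = margY q} :=
    ⟨hp', hX', hY'⟩
  exact hmin hmem

lemma projE_le_relEnt {q p R : X × Y → ℝ} (h : Coupled q p) (hR : IsPos R) :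
    projE q R ≤ relEnt p R := by
  refine csInf_le ⟨0, ?_⟩ ⟨p, h.2.1, h.2.2.1, h.2.2.2, rfl⟩
  rintro d ⟨p', hp₁, -, -, rfl⟩
  exact relEnt_nonneg hp₁ hR

/-! ### The constrained value function -/

/-- The least `D(q‖Q)` under the constraint `E(q‖P) ≤ ρ`. -/
def optVal (P Q : X × Y → ℝ) (ρ : ℝ) : ℝ :=
  sInf {d : ℝ | ∃ q : X × Y → ℝ, IsDist q ∧ projE q P ≤ ρ ∧ d = relEnt q Q}

lemma optVal_le {P Q q p : X × Y → ℝ} {ρ : ℝ} (hP : IsPos P) (hQ : IsPos Q) (h : Coupled q p)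
    (hρ : relEnt p P ≤ ρ) : optVal P Q ρ ≤ relEnt q Q := by
  refine csInf_le ⟨0, ?_⟩ ⟨q, h.1, (projE_le_relEnt h hP).trans hρ, rfl⟩
  rintro d ⟨q', hq', -, rfl⟩
  exact relEnt_nonneg hq' hQ

lemma exists_relEnt_eq_optVal {P Q : X × Y → ℝ} {ρ : ℝ} (hP : IsPos P) (hQ : IsPos Q)
    (hρ : 0 ≤ ρ) : ∃ q p, Coupled q p ∧ relEnt p P ≤ ρ ∧ relEnt q Q = optVal P Q ρ := by
  have hc : IsCompact {w : (X × Y → ℝ) × (X × Y → ℝ) | Coupled w.1 w.2 ∧ relEnt w.2 P ≤ ρ} :=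
    isCompact_setOf_coupled.inter_right
      (isClosed_le ((continuous_relEnt hP).comp continuous_snd) continuous_const)
  obtain ⟨⟨q, p⟩, ⟨hqp, hle⟩, hmin⟩ := hc.exists_isMinOn
    ⟨(P, P), ⟨hP.isDist, hP.isDist, rfl, rfl⟩, by simpa [relEnt_self hP] using hρ⟩
    ((continuous_relEnt hQ).comp continuous_fst).continuousOn
  refine ⟨q, p, hqp, hle, Eq.symm ?_⟩
  refine IsLeast.csInf_eq ⟨⟨q, hqp.1, (projE_le_relEnt hqp hP).trans hle, rfl⟩, ?_⟩
  rintro d ⟨q', hq', hle', rfl⟩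
  obtain ⟨p', hqp', hp'⟩ := exists_relEnt_eq_projE hq' hP
  have hmem : (q', p') ∈ {w : (X × Y → ℝ) × (X × Y → ℝ) | Coupled w.1 w.2 ∧ relEnt w.2 P ≤ ρ} :=
    ⟨hqp', hp'.trans_le hle'⟩
  exact hmin hmem

lemma optVal_antitone {P Q : X × Y → ℝ} {ρ ρ' : ℝ} (hP : IsPos P) (hQ : IsPos Q)
    (hρ : 0 ≤ ρ) (h : ρ ≤ ρ') : optVal P Q ρ' ≤ optVal P Q ρ := by
  obtain ⟨q, p, hqp, hle, heq⟩ := exists_relEnt_eq_optVal hP hQ hρ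
  exact heq ▸ optVal_le hP hQ hqp (hle.trans h)

lemma convexOn_optVal {P Q : X × Y → ℝ} (hP : IsPos P) (hQ : IsPos Q) :
    ConvexOn ℝ (Set.Ici 0) (optVal P Q) := by
  refine ⟨convex_Ici 0, ?_⟩
  intro ρ₁ h₁ ρ₂ h₂ s t hs ht hst
  obtain ⟨q₁, p₁, hqp₁, hle₁, heq₁⟩ := exists_relEnt_eq_optVal hP hQ h₁
  obtain ⟨q₂, p₂, hqp₂, hle₂, heq₂⟩ := exists_relEnt_eq_optVal hP hQ h₂
  obtain rfl : s = 1 - t := by linarith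
  have ht1 : t ≤ 1 := by linarith
  simp only [smul_eq_mul]
  rw [← heq₁, ← heq₂]
  refine (optVal_le hP hQ (hqp₁.mix hqp₂ ht ht1) ?_).trans
    (relEnt_mix_le hqp₁.1 hqp₂.1 hQ ht ht1)
  exact (relEnt_mix_le hqp₁.2.1 hqp₂.2.1 hP ht ht1).trans (by gcongr)

lemma ConvexOn.exists_subgradient {S : Set ℝ} {f : ℝ → ℝ} {x : ℝ} (hf : ConvexOn ℝ S f)
    (hx : x ∈ interior S) : ∃ c, ∀ y ∈ S, f x + c * (y - x) ≤ f y := by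
  refine ⟨derivWithin f (Set.Ioi x) x, fun y hy => ?_⟩
  rcases lt_trichotomy y x with h | rfl | h
  · have h1 := (hf.slope_le_leftDeriv_of_mem_interior hy hx h).trans
      (hf.leftDeriv_le_rightDeriv_of_mem_interior hx)
    rw [slope_def_field, div_le_iff₀ (by linarith)] at h1
    linarith
  · simp
  · have h1 := hf.rightDeriv_le_slope_of_mem_interior hx hy h
    rw [slope_def_field, le_div_iff₀ (by linarith)] at h1
    linarith

/-! ### Minimizers of the Lagrangian -/

/-- The pair `(q, p)` minimizes `D(q‖Q) + μ D(p‖P)` among pairs with equal marginals. -/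
def IsLagrangeMin (P Q : X × Y → ℝ) (μ : ℝ) (q p : X × Y → ℝ) : Prop :=
  Coupled q p ∧ ∀ q' p', Coupled q' p' →
    relEnt q Q + μ * relEnt p P ≤ relEnt q' Q + μ * relEnt p' P

lemma exists_isLagrangeMin {P Q : X × Y → ℝ} {r : ℝ} (hP : IsPos P) (hQ : IsPos Q)
    (hr0 : 0 < r) (hr1 : r < projE Q P) :
    ∃ μ q p, 0 < μ ∧ IsLagrangeMin P Q μ q p ∧ relEnt p P = r ∧ relEnt q Q = optVal P Q r ∧
      0 < optVal P Q r := by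
  obtain ⟨q, p, hqp, hle, heq⟩ := exists_relEnt_eq_optVal hP hQ hr0.le
  have hpos : 0 < optVal P Q r := by
    rw [← heq]
    refine (relEnt_nonneg hqp.1 hQ).lt_of_ne fun h => ?_
    obtain rfl := eq_of_relEnt_eq_zero hqp.1 hQ h.symm
    linarith [projE_le_relEnt hqp hP]
  obtain ⟨c, hc⟩ := (convexOn_optVal hP hQ).exists_subgradient (x := r) (by simpa using hr0)
  have hc0 : c < 0 := by
    obtain ⟨p', hQp', hp'⟩ := exists_relEnt_eq_projE hQ.isDist hP
    have h1 := hc (projE Q P) (Set.mem_Ici.2 (by linarith))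
    have h2 := optVal_le hP hQ hQp' hp'.le
    rw [relEnt_self hQ] at h2
    by_contra! h
    nlinarith
  have hp : relEnt p P = r := by
    refine le_antisymm hle ?_
    have h1 := hc (relEnt p P) (relEnt_nonneg hqp.2.1 hP)
    have h2 := optVal_le hP hQ hqp le_rfl
    nlinarith
  refine ⟨-c, q, p, by linarith, ⟨hqp, fun q' p' h' => ?_⟩, hp, heq, hpos⟩
  have h1 := hc (relEnt p' P) (relEnt_nonneg h'.2.1 hP)
  have h2 := optVal_le hP hQ h' le_rfl
  rw [heq, hp]
  linarith

lemma exists_mem_Ioc_add_mul_log_neg {a : ℝ} (ha : 0 < a) (C : ℝ) :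
    ∃ t : ℝ, 0 < t ∧ t ≤ 1 ∧ C + a * Real.log t < 0 := by
  refine ⟨Real.exp (-((|C| + 1) / a)), Real.exp_pos _, ?_, ?_⟩
  · rw [Real.exp_le_one_iff, neg_nonpos]
    positivity
  · rw [Real.log_exp, mul_neg, mul_div_cancel₀ _ ha.ne']
    linarith [le_abs_self C]

lemma IsLagrangeMin.pos {P Q q p : X × Y → ℝ} {μ : ℝ} (hP : IsPos P) (hQ : IsPos Q) (hμ : 0 < μ)
    (h : IsLagrangeMin P Q μ q p) : (∀ z, 0 < q z) ∧ ∀ z, 0 < p z := by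
  have hPP : Coupled P P := ⟨hP.isDist, hP.isDist, rfl, rfl⟩
  constructor
  · intro z
    refine (h.1.1.1 z).lt_of_ne fun hz => ?_
    obtain ⟨t, ht0, ht1, ht⟩ := exists_mem_Ioc_add_mul_log_neg (hP.1 z)
      (relEnt P Q + μ * relEnt P P - (relEnt q Q + μ * relEnt p P))
    have h1 := h.2 _ _ (h.1.mix hPP ht0.le ht1)
    have h2 := relEnt_mix_le_of_eq_zero h.1.1 hP hQ ht0 ht1 hz.symm
    have h3 := mul_le_mul_of_nonneg_left (relEnt_mix_le h.1.2.1 hP.isDist hP ht0.le ht1) hμ.le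
    have h4 := mul_neg_of_pos_of_neg ht0 ht
    nlinarith
  · intro z
    refine (h.1.2.1.1 z).lt_of_ne fun hz => ?_
    obtain ⟨t, ht0, ht1, ht⟩ := exists_mem_Ioc_add_mul_log_neg (mul_pos hμ (hP.1 z))
      (relEnt P Q + μ * relEnt P P - (relEnt q Q + μ * relEnt p P))
    have h1 := h.2 _ _ (h.1.mix hPP ht0.le ht1)
    have h2 := mul_le_mul_of_nonneg_left
      (relEnt_mix_le_of_eq_zero h.1.2.1 hP hP ht0 ht1 hz.symm) hμ.le
    have h3 := relEnt_mix_le h.1.1 hP.isDist hQ ht0.le ht1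
    have h4 := mul_neg_of_pos_of_neg ht0 ht
    nlinarith

lemma eventually_isDist_line {q δ : X × Y → ℝ} (hq : ∀ z, 0 < q z) (hq1 : ∑ z, q z = 1)
    (hδ : ∑ z, δ z = 0) : ∀ᶠ t : ℝ in nhds 0, IsDist fun z => q z + t * δ z := by
  have h : ∀ᶠ t : ℝ in nhds 0, ∀ z, 0 < q z + t * δ z := by
    rw [Filter.eventually_all]
    intro z
    have hc : Continuous fun t : ℝ => q z + t * δ z := by fun_prop
    exact hc.continuousAt.eventually_const_lt (by simpa using hq z)
  filter_upwards [h] with t ht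
  refine ⟨fun z => (ht z).le, ?_⟩
  rw [Finset.sum_add_distrib, ← Finset.mul_sum, hq1, hδ]
  simp

/-- First-order condition along directions with equal marginals and zero total mass. -/
lemma IsLagrangeMin.stationary {P Q q p δ ε : X × Y → ℝ} {μ : ℝ} (hP : IsPos P) (hQ : IsPos Q)
    (h : IsLagrangeMin P Q μ q p) (hq : ∀ z, 0 < q z) (hp : ∀ z, 0 < p z)
    (hδ : ∑ z, δ z = 0) (hε : ∑ z, ε z = 0)
    (hX : margX ε = margX δ) (hY : margY ε = margY δ) :
    ∑ z, δ z * Real.log (q z / Q z) + μ * ∑ z, ε z * Real.log (p z / P z) = 0 := by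
  have hd := (hasDerivAt_relEnt_line hq hQ hδ).add ((hasDerivAt_relEnt_line hp hP hε).const_mul μ)
  refine IsLocalMin.hasDerivAt_eq_zero ?_ hd
  filter_upwards [eventually_isDist_line hq h.1.1.2 hδ, eventually_isDist_line hp h.1.2.1.2 hε]
    with t h1 h2
  have := h.2 _ _ ⟨h1, h2, ?_, ?_⟩
  · simpa using this
  · funext x
    have e1 := congrFun hX x
    have e2 := congrFun h.1.2.2.1 x
    simp only [margX, Finset.sum_add_distrib, ← Finset.mul_sum] at *
    rw [e1, e2]
  · funext y
    have e1 := congrFun hY y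
    have e2 := congrFun h.1.2.2.2 y
    simp only [margY, Finset.sum_add_distrib, ← Finset.mul_sum] at *
    rw [e1, e2]

/-- A function orthogonal to all directions with vanishing marginals splits as a sum. -/
lemma exists_add_of_forall_marg_eq_zero [Nonempty X] [Nonempty Y] {u : X × Y → ℝ}
    (h : ∀ δ : X × Y → ℝ, margX δ = 0 → margY δ = 0 → ∑ z, δ z * u z = 0) :
    ∃ (a₁ : X → ℝ) (a₂ : Y → ℝ), ∀ x y, u (x, y) = a₁ x + a₂ y := by
  obtain ⟨x₀⟩ := ‹Nonempty X›
  obtain ⟨y₀⟩ := ‹Nonempty Y›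
  refine ⟨fun x => u (x, y₀) - u (x₀, y₀), fun y => u (x₀, y), fun x y => ?_⟩
  have key : ∀ (f : X → ℝ) (g : Y → ℝ), ∑ a, f a = 0 → ∑ b, g b = 0 →
      ∑ a, f a * ∑ b, g b * u (a, b) = 0 := by
    intro f g hf hg
    have h1 := h (fun z => f z.1 * g z.2)
      (by funext a; simp only [margX, ← Finset.mul_sum, hg, mul_zero, Pi.zero_apply])
      (by funext b; simp only [margY, ← Finset.sum_mul, hf, zero_mul, Pi.zero_apply])
    simpa only [Fintype.sum_prod_type, mul_assoc, ← Finset.mul_sum] using h1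
  have h1 := key (Pi.single x 1 - Pi.single x₀ 1) (Pi.single y 1 - Pi.single y₀ 1)
    (by simp) (by simp)
  simp only [Pi.sub_apply, sub_mul, Finset.sum_sub_distrib, Pi.single_apply, ite_mul, one_mul,
    zero_mul, Finset.sum_ite_eq', Finset.mem_univ, if_true] at h1
  linarith

lemma sum_eq_sum_margX (δ : X × Y → ℝ) : ∑ z, δ z = ∑ x, margX δ x :=
  Fintype.sum_prod_type _

lemma IsLagrangeMin.sameCorr [Nonempty X] [Nonempty Y] {P Q q p : X × Y → ℝ} {μ : ℝ}
    (hP : IsPos P) (hQ : IsPos Q) (hμ : 0 < μ) (h : IsLagrangeMin P Q μ q p) :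
    SameCorr q Q ∧ SameCorr p P := by
  obtain ⟨hq, hp⟩ := h.pos hP hQ hμ
  have hz : ∑ z : X × Y, (0 : X × Y → ℝ) z = 0 := by simp
  have hzX : margX (0 : X × Y → ℝ) = 0 := by funext x; simp [margX]
  have hzY : margY (0 : X × Y → ℝ) = 0 := by funext y; simp [margY]
  constructor
  · refine exists_add_of_forall_marg_eq_zero (u := fun z => Real.log (q z / Q z))
      fun δ hX hY => ?_
    simpa using h.stationary hP hQ hq hp (δ := δ) (ε := 0)
      (by simp [sum_eq_sum_margX, hX]) hz (hzX.trans hX.symm) (hzY.trans hY.symm)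
  · refine exists_add_of_forall_marg_eq_zero (u := fun z => Real.log (p z / P z))
      fun ε hX hY => ?_
    simpa [hμ.ne'] using h.stationary hP hQ hq hp (δ := 0) (ε := ε)
      hz (by simp [sum_eq_sum_margX, hX]) (hX.trans hzX.symm) (hY.trans hzY.symm)

lemma IsLagrangeMin.exists_const [Nonempty X] [Nonempty Y] {P Q q p : X × Y → ℝ} {μ : ℝ}
    (hP : IsPos P) (hQ : IsPos Q) (hμ : 0 < μ) (h : IsLagrangeMin P Q μ q p) :
    ∃ c, ∀ z, Real.log (q z / Q z) + μ * Real.log (p z / P z) = c := by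
  obtain ⟨hq, hp⟩ := h.pos hP hQ hμ
  obtain ⟨z₀⟩ : Nonempty (X × Y) := inferInstance
  refine ⟨Real.log (q z₀ / Q z₀) + μ * Real.log (p z₀ / P z₀), fun z => ?_⟩
  have h1 := h.stationary hP hQ hq hp
    (δ := fun w => (if w = z then 1 else 0) - (if w = z₀ then 1 else 0))
    (ε := fun w => (if w = z then 1 else 0) - (if w = z₀ then 1 else 0))
    (by simp) (by simp) rfl rfl
  simp only [sub_mul, Finset.sum_sub_distrib, ite_mul, one_mul, zero_mul, Finset.sum_ite_eq',
    Finset.mem_univ, if_true] at h1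
  linarith

/-! ### Pairs satisfying the characterizing conditions -/

lemma IsDist.sum_mul_affine {q : X × Y → ℝ} (hq : IsDist q) (a b : ℝ) (u : X × Y → ℝ) :
    ∑ z, q z * (a * u z + b) = a * ∑ z, q z * u z + b := by
  simp only [mul_add, Finset.sum_add_distrib, ← Finset.sum_mul, hq.2, one_mul, Finset.mul_sum]
  simp only [mul_left_comm]

lemma NPpair.exists_neg_slope {P Q Ql Pl : X × Y → ℝ} {lam : ℝ} (hP : IsPos P) (hQ : IsPos Q)
    (h : NPpair P Q lam Ql Pl) : ∃ a b : ℝ, a < 0 ∧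
      ∀ z, Real.log (Pl z / P z) = a * Real.log (Ql z / Q z) + b := by
  obtain ⟨hQl, hPl, hcQ, hcP, ⟨a, b, ha, hab⟩, hD, hX, hY, hlt, hgt⟩ := h
  refine ⟨a, b, ?_, hab⟩
  set u : X × Y → ℝ := fun z => Real.log (Ql z / Q z) with hu
  have hPl_u : ∑ z, Pl z * u z = ∑ z, Ql z * u z := sum_mul_log_eq_of_sameCorr hcQ hX hY
  have eQ : relEnt Ql Q = ∑ z, Ql z * u z := rfl
  have eP : relEnt Pl P = a * ∑ z, Ql z * u z + b := by
    rw [← hPl_u, ← hPl.isDist.sum_mul_affine]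
    exact Finset.sum_congr rfl fun z _ => by rw [hab]
  have key : ∀ {q : X × Y → ℝ}, IsDist q →
      ∑ z, q z * (Real.log (Ql z / Q z) - Real.log (Pl z / P z))
        = (1 - a) * ∑ z, q z * u z - b := by
    intro q hq
    rw [sub_eq_add_neg, ← hq.sum_mul_affine]
    exact Finset.sum_congr rfl fun z _ => by rw [hab]; simp only [hu]; ring
  rw [key hQ.isDist] at hlt
  rw [key hP.isDist] at hgt
  have hnQ : ∑ z, Q z * u z ≤ 0 := sum_mul_log_div_nonpos hQl hQ
  have hnP : a * ∑ z, P z * u z + b ≤ 0 := by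
    rw [← hP.isDist.sum_mul_affine]
    simpa only [hab] using sum_mul_log_div_nonpos hPl hP
  have h0Q := relEnt_nonneg hQl.isDist hQ
  have h0P := relEnt_nonneg hPl.isDist hP
  rw [eQ] at h0Q hD
  rw [eP] at h0P hD
  have ha1 : a < 1 := by
    by_contra! hcon
    nlinarith
  by_contra! hcon
  have hpos : 0 < a := hcon.lt_of_ne' ha
  have h1 : a * ∑ z, P z * u z ≤ a * ∑ z, Ql z * u z := by linarith
  have h2 := le_of_mul_le_mul_left h1 hpos
  nlinarith

/-- Optimality of the pair, with a quantitative gap. -/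
lemma NPpair.relEnt_add_le {P Q Ql Pl q p : X × Y → ℝ} {lam : ℝ} (hP : IsPos P) (hQ : IsPos Q)
    (h : NPpair P Q lam Ql Pl) (hqp : Coupled q p) (hle : relEnt p P ≤ relEnt Pl P) :
    relEnt q Ql + relEnt Ql Q ≤ relEnt q Q := by
  obtain ⟨a, b, ha, hab⟩ := h.exists_neg_slope hP hQ
  obtain ⟨hQl, hPl, hcQ, hcP, -, -, hX, hY, -, -⟩ := h
  have e1 := relEnt_eq_add_sum (q := q) hQl hQ
  have e2 := relEnt_eq_add_sum (q := p) hPl hP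
  have e3 : ∑ z, p z * Real.log (Pl z / P z)
      = a * ∑ z, q z * Real.log (Ql z / Q z) + b := by
    rw [sum_mul_log_eq_of_sameCorr hcP hqp.2.2.1 hqp.2.2.2, ← hqp.1.sum_mul_affine]
    exact Finset.sum_congr rfl fun z _ => by rw [hab]
  have e4 : relEnt Pl P = a * relEnt Ql Q + b := by
    unfold relEnt
    rw [sum_mul_log_eq_of_sameCorr hcP hX hY, ← hQl.isDist.sum_mul_affine]
    exact Finset.sum_congr rfl fun z _ => by rw [hab]
  have h0 := relEnt_nonneg hqp.2.1 hPl
  nlinarith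

lemma NPpair.relEnt_eq {P Q Ql Pl : X × Y → ℝ} {r : ℝ} (hP : IsPos P) (hQ : IsPos Q)
    (hr : 0 ≤ r) (h : NPpair P Q (-r + optVal P Q r) Ql Pl) :
    relEnt Pl P = r ∧ relEnt Ql Q = optVal P Q r := by
  have hD := h.2.2.2.2.2.1
  have hX := h.2.2.2.2.2.2.1
  have hY := h.2.2.2.2.2.2.2.1
  have hc : Coupled Ql Pl := ⟨h.1.isDist, h.2.1.isDist, hX, hY⟩
  have h0 := relEnt_nonneg h.2.1.isDist hP
  have hval : relEnt Ql Q = optVal P Q (relEnt Pl P) := by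
    refine le_antisymm ?_ (optVal_le hP hQ hc le_rfl)
    obtain ⟨q, p, hqp, hle, heq⟩ := exists_relEnt_eq_optVal hP hQ h0
    rw [← heq]
    linarith [h.relEnt_add_le hP hQ hqp hle, relEnt_nonneg hqp.1 h.1]
  have hr' : relEnt Pl P = r := by
    rcases le_total (relEnt Pl P) r with hle | hle
    · linarith [optVal_antitone hP hQ h0 hle]
    · linarith [optVal_antitone hP hQ hr hle]
  exact ⟨hr', hr' ▸ hval⟩

lemma NPpair.unique {P Q Ql Pl Ql' Pl' : X × Y → ℝ} {r : ℝ} (hP : IsPos P) (hQ : IsPos Q)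
    (hr : 0 ≤ r) (h : NPpair P Q (-r + optVal P Q r) Ql Pl)
    (h' : NPpair P Q (-r + optVal P Q r) Ql' Pl') : Ql' = Ql ∧ Pl' = Pl := by
  obtain ⟨e1, e2⟩ := h.relEnt_eq hP hQ hr
  obtain ⟨e1', e2'⟩ := h'.relEnt_eq hP hQ hr
  have hX' := h'.2.2.2.2.2.2.1
  have hY' := h'.2.2.2.2.2.2.2.1
  have hc : Coupled Ql' Pl' := ⟨h'.1.isDist, h'.2.1.isDist, hX', hY'⟩
  have hgap := h.relEnt_add_le hP hQ hc (by rw [e1, e1'])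
  have hQeq : Ql' = Ql := eq_of_relEnt_eq_zero h'.1.isDist h.1
    (le_antisymm (by linarith) (relEnt_nonneg h'.1.isDist h.1))
  refine ⟨hQeq, eq_of_relEnt_eq_zero h'.2.1.isDist h.2.1 ?_⟩
  have hpyth := relEnt_pythagoras (p := Pl') h.2.1 hP h.2.2.2.1
    (by rw [hX', hQeq, h.2.2.2.2.2.2.1]) (by rw [hY', hQeq, h.2.2.2.2.2.2.2.1])
  linarith

lemma exists_NPpair [Nonempty X] [Nonempty Y] {P Q : X × Y → ℝ} {r : ℝ} (hP : IsPos P)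
    (hQ : IsPos Q) (hr0 : 0 < r) (hr1 : r < projE Q P) :
    ∃ Ql Pl, NPpair P Q (-r + optVal P Q r) Ql Pl := by
  obtain ⟨μ, q, p, hμ, hmin, hp, hq, hpos⟩ := exists_isLagrangeMin hP hQ hr0 hr1
  obtain ⟨hq0, hp0⟩ := hmin.pos hP hQ hμ
  obtain ⟨hcQ, hcP⟩ := hmin.sameCorr hP hQ hμ
  obtain ⟨c, hc⟩ := hmin.exists_const hP hQ hμ
  have hqpos : IsPos q := ⟨hq0, hmin.1.1.2⟩
  have hppos : IsPos p := ⟨hp0, hmin.1.2.1.2⟩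
  have hqp := sum_mul_log_eq_of_sameCorr hcQ hmin.1.2.2.1 hmin.1.2.2.2
  have eu : ∀ {w : X × Y → ℝ}, IsDist w →
      ∑ z, w z * Real.log (q z / Q z) = -μ * ∑ z, w z * Real.log (p z / P z) + c := by
    intro w hw
    rw [← hw.sum_mul_affine]
    exact Finset.sum_congr rfl fun z _ => by rw [← hc z]; ring
  have hval : optVal P Q r = -μ * r + c := by
    rw [← hq, ← hp]
    exact hqp.symm.trans (eu hppos.isDist)
  have esub : ∀ w : X × Y → ℝ, ∑ z, w z * (Real.log (q z / Q z) - Real.log (p z / P z))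
      = ∑ z, w z * Real.log (q z / Q z) - ∑ z, w z * Real.log (p z / P z) := by
    intro w
    simp only [mul_sub, Finset.sum_sub_distrib]
  have hnQ := sum_mul_log_div_nonpos hqpos hQ
  have hnP := sum_mul_log_div_nonpos hppos hP
  refine ⟨q, p, hqpos, hppos, hcQ, hcP, ⟨-μ⁻¹, μ⁻¹ * c, by simpa using hμ.ne', fun z => ?_⟩,
    by rw [hp, hq]; ring, hmin.1.2.2.1, hmin.1.2.2.2, ?_, ?_⟩
  · rw [← hc z]
    field_simp
    ring
  · have h1 := eu hQ.isDist
    rw [esub]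
    have h2 : μ * r < μ * ∑ z, Q z * Real.log (p z / P z) := by linarith
    linarith [lt_of_mul_lt_mul_left h2 hμ.le]
  · have h1 := eu hP.isDist
    rw [esub]
    nlinarith

/-- characterization of the optimizer pair of `F(r)`. -/
theorem NPpair_exists_unique_and_attains
    [Nonempty X] [Nonempty Y]
    (P Q : X × Y → ℝ) (hP : IsPos P) (hQ : IsPos Q)
    (r : ℝ) (hr0 : 0 < r) (hr1 : r < projE Q P)
    (Fr : ℝ)
    (hFr : Fr = sInf { d : ℝ | ∃ Qbar : X × Y → ℝ,
        IsDist Qbar ∧ projE Qbar P ≤ r ∧ d = relEnt Qbar Q })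
    (lam : ℝ) (hlam : lam = -r + Fr) :
    (∃! QP : (X × Y → ℝ) × (X × Y → ℝ), NPpair P Q lam QP.1 QP.2) ∧
    (∀ Ql Pl : X × Y → ℝ, NPpair P Q lam Ql Pl →
      projE Ql P = r ∧ relEnt Pl P = r ∧ projE Pl Q = Fr ∧ relEnt Ql Q = Fr) := by
  change Fr = optVal P Q r at hFr
  subst hFr hlam
  refine ⟨?_, fun Ql Pl h => ?_⟩
  · obtain ⟨Ql, Pl, h⟩ := exists_NPpair hP hQ hr0 hr1
    refine ⟨(Ql, Pl), h, fun QP h' => ?_⟩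
    obtain ⟨h1, h2⟩ := h.unique hP hQ hr0.le h'
    exact Prod.ext h1 h2
  · obtain ⟨h1, h2⟩ := h.relEnt_eq hP hQ hr0.le
    have hX := h.2.2.2.2.2.2.1
    have hY := h.2.2.2.2.2.2.2.1
    exact ⟨(projE_eq_of_sameCorr h.2.1 hP h.2.2.2.1 hX hY).trans h1, h1,
      (projE_eq_of_sameCorr h.1 hQ h.2.2.1 hX.symm hY.symm).trans h2, h2⟩
end
end

section
/- Let P and Q be positive joint distributions on 𝒳 × 𝒴, let P* be a minimizer of min{ D(P̃‖Q) : P̃ a joint distribution with P̃_X = P_X and P̃_Y = P_Y }, and define ȷ(x,y) = log(P*(x,y)/Q(x,y)). Let σ² = Σ_{x,y} P*(x,y)·(ȷ(x,y) − D(P*‖Q))² be the variance of ȷ under P* and T = Σ_{x,y} P*(x,y)·|ȷ(x,y) − D(P*‖Q)|³ its centered absolute third moment, and assume σ² > 0. Then for every n ≥ 1 and every τ ∈ ℝ: Q^n({(x,y) : (1/n)Σ_{i=1}^n ȷ(x_i,y_i) > τ}) ≤ 2·(log 2/√(2π) + 12T/σ²)·exp(−nτ)/(σ·√n). -/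
open scoped Classical BigOperators

noncomputable section

variable {X Y : Type*} [Fintype X] [Fintype Y]

theorem norm_cexp_mul_I_sub_taylor_le_of_nonneg {u : ℝ} (hu : 0 ≤ u) :
    ‖Complex.exp (u * Complex.I) - (1 + u * Complex.I - u ^ 2 / 2)‖ ≤ u ^ 3 / 6 := by
  have hexp (x : ℝ) : HasDerivAt (fun x : ℝ => Complex.exp (x * Complex.I))
      (Complex.exp (x * Complex.I) * Complex.I) x := by
    simpa using ((Complex.ofRealCLM.hasDerivAt (x := x)).mul_const Complex.I).cexp
  have hid (x : ℝ) : HasDerivAt (fun x : ℝ => (x : ℂ) * Complex.I) Complex.I x := by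
    simpa using (Complex.ofRealCLM.hasDerivAt (x := x)).mul_const Complex.I
  have hsq (x : ℝ) : HasDerivAt (fun x : ℝ => (x : ℂ) ^ 2 / 2) (x : ℂ) x := by
    have h := ((Complex.ofRealCLM.hasDerivAt (x := x)).pow 2).div_const 2
    simpa using h
  have first : ∀ x ∈ Set.Icc 0 u,
      ‖Complex.exp (x * Complex.I) - (1 + x * Complex.I)‖ ≤ x ^ 2 / 2 := by
    have hd (x : ℝ) : HasDerivAt (fun x : ℝ => Complex.exp (x * Complex.I) - (1 + x * Complex.I))
        (Complex.exp (x * Complex.I) * Complex.I - Complex.I) x :=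
      (hexp x).sub ((hid x).const_add 1)
    have hB (x : ℝ) : HasDerivAt (fun x : ℝ => x ^ 2 / 2) x x := by
      simpa using (hasDerivAt_pow 2 x).div_const 2
    refine image_norm_le_of_norm_deriv_right_le_deriv_boundary
      (fun x _ => (hd x).continuousAt.continuousWithinAt) (fun x _ => (hd x).hasDerivWithinAt)
      (by simp) hB ?_
    intro x hx
    have h := Real.norm_exp_I_mul_ofReal_sub_one_le (x := x)
    rw [← sub_one_mul, norm_mul, Complex.norm_I, mul_one, mul_comm (x : ℂ)]
    simpa [abs_of_nonneg hx.1] using h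
  have hd (x : ℝ) : HasDerivAt
      (fun x : ℝ => Complex.exp (x * Complex.I) - (1 + x * Complex.I - x ^ 2 / 2))
      (Complex.exp (x * Complex.I) * Complex.I - (Complex.I - x)) x :=
    (hexp x).sub (((hid x).const_add 1).sub (hsq x))
  have hB (x : ℝ) : HasDerivAt (fun x : ℝ => x ^ 3 / 6) (x ^ 2 / 2) x := by
    have h := (hasDerivAt_pow 3 x).div_const 6
    refine h.congr_deriv ?_
    norm_num
    ring
  refine image_norm_le_of_norm_deriv_right_le_deriv_boundary
      (fun x _ => (hd x).continuousAt.continuousWithinAt) (fun x _ => (hd x).hasDerivWithinAt)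
      (by simp) hB ?_ ⟨hu, le_rfl⟩
  intro x hx
  have h := first x ⟨hx.1, hx.2.le⟩
  have e : Complex.exp (x * Complex.I) * Complex.I - (Complex.I - x)
      = (Complex.exp (x * Complex.I) - (1 + x * Complex.I)) * Complex.I := by
    linear_combination (x : ℂ) * Complex.I_mul_I
  rw [e, norm_mul, Complex.norm_I, mul_one]
  exact h

/-- Second-order Taylor bound for `u ↦ exp (i u)` on the real line. -/
theorem norm_cexp_mul_I_sub_taylor_le (u : ℝ) :
    ‖Complex.exp (u * Complex.I) - (1 + u * Complex.I - u ^ 2 / 2)‖ ≤ |u| ^ 3 / 6 := by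
  rcases le_total 0 u with hu | hu
  · rw [abs_of_nonneg hu]
    exact norm_cexp_mul_I_sub_taylor_le_of_nonneg hu
  · have h := norm_cexp_mul_I_sub_taylor_le_of_nonneg (neg_nonneg.2 hu)
    rw [abs_of_nonpos hu, ← Complex.norm_conj]
    convert h using 3
    simp [← Complex.exp_conj, Complex.conj_ofNat]

theorem nonneg_of_deriv_nonneg {f f' : ℝ → ℝ} (hf : ∀ x, HasDerivAt f (f' x) x) (h0 : 0 ≤ f 0)
    (hf' : ∀ x, 0 ≤ x → 0 ≤ f' x) {x : ℝ} (hx : 0 ≤ x) : 0 ≤ f x := by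
  have hm : MonotoneOn f (Set.Ici 0) := by
    refine monotoneOn_of_deriv_nonneg (convex_Ici 0)
      (fun x _ => (hf x).continuousAt.continuousWithinAt)
      (fun x _ => (hf x).differentiableAt.differentiableWithinAt) fun x hx => ?_
    rw [interior_Ici] at hx
    rw [(hf x).deriv]
    exact hf' x (le_of_lt hx)
  exact h0.trans (hm Set.self_mem_Ici hx hx)

theorem taylor_six_le_cos {x : ℝ} (hx : 0 ≤ x) :
    1 - x ^ 2 / 2 + x ^ 4 / 24 - x ^ 6 / 720 ≤ Real.cos x := by
  have hp (n : ℕ) (c x : ℝ) : HasDerivAt (fun x : ℝ => x ^ n / c) (n * x ^ (n - 1) / c) x :=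
    (hasDerivAt_pow n x).div_const c
  have s3 : ∀ x : ℝ, 0 ≤ x → 0 ≤ Real.sin x - (x - x ^ 3 / 6) := fun x hx =>
    nonneg_of_deriv_nonneg (fun x => (Real.hasDerivAt_sin x).sub ((hasDerivAt_id' x).sub (hp 3 6 x)))
      (by simp) (fun x _ => by
        have := Real.one_sub_sq_div_two_le_cos (x := x)
        norm_num; linarith) hx
  have c4 : ∀ x : ℝ, 0 ≤ x → 0 ≤ 1 - x ^ 2 / 2 + x ^ 4 / 24 - Real.cos x := fun x hx =>
    nonneg_of_deriv_nonneg
      (fun x => (((hp 2 2 x).const_sub 1).add (hp 4 24 x)).sub (Real.hasDerivAt_cos x))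
      (by simp) (fun x hx => by
        have := s3 x hx
        norm_num; linarith) hx
  have s5 : ∀ x : ℝ, 0 ≤ x → 0 ≤ x - x ^ 3 / 6 + x ^ 5 / 120 - Real.sin x := fun x hx =>
    nonneg_of_deriv_nonneg
      (fun x => (((hasDerivAt_id' x).sub (hp 3 6 x)).add (hp 5 120 x)).sub (Real.hasDerivAt_sin x))
      (by simp) (fun x hx => by
        have := c4 x hx
        norm_num; linarith) hx
  have c6 := nonneg_of_deriv_nonneg
      (fun x => (Real.hasDerivAt_cos x).sub
        ((((hp 2 2 x).const_sub 1).add (hp 4 24 x)).sub (hp 6 720 x)))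
      (by simp) (fun x hx => by
        have := s5 x hx
        norm_num; linarith) hx
  simpa using c6

/-- The Fejér kernel (up to normalisation), as a cosine transform of a triangle function. -/
def fejer (x : ℝ) : ℝ := ∫ t in (0 : ℝ)..1, (1 - t) * Real.cos (t * x)

theorem continuous_fejer : Continuous fejer :=
  intervalIntegral.continuous_parametric_intervalIntegral_of_continuous' (by fun_prop) 0 1

theorem fejer_nonneg (x : ℝ) : 0 ≤ fejer x := by
  rcases eq_or_ne x 0 with rfl | hx
  · refine intervalIntegral.integral_nonneg zero_le_one fun t ht => ?_
    simpa using ht.2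
  · have hd (t : ℝ) : HasDerivAt
        (fun t => (1 - t) * (Real.sin (t * x) / x) - Real.cos (t * x) / x ^ 2)
        ((1 - t) * Real.cos (t * x)) t := by
      have hl : HasDerivAt (fun t : ℝ => t * x) x t := by
        simpa using (hasDerivAt_id' t).mul_const x
      have h := (((hasDerivAt_id' t).const_sub 1).mul (hl.sin.div_const x)).sub
        (hl.cos.div_const (x ^ 2))
      refine h.congr_deriv ?_
      field_simp
      ring
    have h : fejer x = (1 - Real.cos x) / x ^ 2 := by
      rw [fejer, intervalIntegral.integral_eq_sub_of_hasDerivAt (fun t _ => hd t)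
        (Continuous.intervalIntegrable (by fun_prop) 0 1)]
      simp
      ring
    rw [h]
    have := Real.cos_le_one x
    exact div_nonneg (by linarith) (sq_nonneg x)

theorem poly_le_fejer (x : ℝ) :
    1 / 2 - x ^ 2 / 24 + x ^ 4 / 720 - x ^ 6 / 40320 ≤ fejer x := by
  have hint : ∫ t in (0 : ℝ)..1,
      (1 - t) * (1 - (t * x) ^ 2 / 2 + (t * x) ^ 4 / 24 - (t * x) ^ 6 / 720)
        = 1 / 2 - x ^ 2 / 24 + x ^ 4 / 720 - x ^ 6 / 40320 := by
    have hd (t : ℝ) : HasDerivAt (fun t : ℝ => t - t ^ 2 / 2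
        - x ^ 2 / 2 * (t ^ 3 / 3 - t ^ 4 / 4) + x ^ 4 / 24 * (t ^ 5 / 5 - t ^ 6 / 6)
        - x ^ 6 / 720 * (t ^ 7 / 7 - t ^ 8 / 8))
        ((1 - t) * (1 - (t * x) ^ 2 / 2 + (t * x) ^ 4 / 24 - (t * x) ^ 6 / 720)) t := by
      have hp (n : ℕ) (c : ℝ) : HasDerivAt (fun x : ℝ => x ^ n / c) (n * t ^ (n - 1) / c) t :=
        (hasDerivAt_pow n t).div_const c
      have h := ((((hasDerivAt_id' t).sub (hp 2 2)).sub
        (((hp 3 3).sub (hp 4 4)).const_mul (x ^ 2 / 2))).add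
        (((hp 5 5).sub (hp 6 6)).const_mul (x ^ 4 / 24))).sub
        (((hp 7 7).sub (hp 8 8)).const_mul (x ^ 6 / 720))
      refine h.congr_deriv ?_
      norm_num
      ring
    rw [intervalIntegral.integral_eq_sub_of_hasDerivAt (fun t _ => hd t)
      (Continuous.intervalIntegrable (by fun_prop) 0 1)]
    norm_num
    ring
  rw [← hint]
  refine intervalIntegral.integral_mono_on zero_le_one
    (Continuous.intervalIntegrable (by fun_prop) 0 1)
    (Continuous.intervalIntegrable (by fun_prop) 0 1) fun t ht => ?_
  refine mul_le_mul_of_nonneg_left ?_ (by linarith [ht.2])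
  have h := taylor_six_le_cos (abs_nonneg (t * x))
  rw [Real.cos_abs] at h
  rwa [Even.pow_abs (by decide), Even.pow_abs (by decide), Even.pow_abs (by decide)] at h

theorem integral_fejer_lower : 2.369 ≤ ∫ x in (-3 : ℝ)..3, fejer x := by
  have hint : ∫ x in (-3 : ℝ)..3, (1 / 2 - x ^ 2 / 24 + x ^ 4 / 720 - x ^ 6 / 40320)
      = 3 - 3 / 4 + 27 / 200 - 243 / 15680 := by
    have hd (x : ℝ) : HasDerivAt
        (fun x : ℝ => x / 2 - x ^ 3 / 72 + x ^ 5 / 3600 - x ^ 7 / 282240)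
        (1 / 2 - x ^ 2 / 24 + x ^ 4 / 720 - x ^ 6 / 40320) x := by
      have hp (n : ℕ) (c : ℝ) : HasDerivAt (fun x : ℝ => x ^ n / c) (n * x ^ (n - 1) / c) x :=
        (hasDerivAt_pow n x).div_const c
      have h := ((((hasDerivAt_id' x).div_const 2).sub (hp 3 72)).add (hp 5 3600)).sub
        (hp 7 282240)
      refine h.congr_deriv ?_
      norm_num
      ring
    rw [intervalIntegral.integral_eq_sub_of_hasDerivAt (fun t _ => hd t)
      (Continuous.intervalIntegrable (by fun_prop) _ _)]
    norm_num
  have h := intervalIntegral.integral_mono_on (μ := MeasureTheory.volume) (a := (-3 : ℝ)) (b := 3)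
    (by norm_num) (Continuous.intervalIntegrable (by fun_prop) _ _)
    (continuous_fejer.intervalIntegrable _ _) (fun x _ => poly_le_fejer x)
  rw [hint] at h
  exact le_trans (by norm_num) h

theorem sum_mul_fejer_le {Ω : Type*} [Fintype Ω] (w S : Ω → ℝ) (v : ℝ) :
    ∑ z, w z * fejer (S z - v)
      ≤ ∫ t in (0 : ℝ)..1, ‖∑ z, (w z : ℂ) * Complex.exp ((t * S z : ℝ) * Complex.I)‖ := by
  simp only [fejer, ← intervalIntegral.integral_const_mul]
  rw [← intervalIntegral.integral_finsetSum (μ := MeasureTheory.volume)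
    fun z _ => Continuous.intervalIntegrable (by fun_prop) 0 1]
  refine intervalIntegral.integral_mono_on zero_le_one
    (Continuous.intervalIntegrable (by fun_prop) 0 1)
    (Continuous.intervalIntegrable (by fun_prop) 0 1) fun t ht => ?_
  set φ := ∑ z, (w z : ℂ) * Complex.exp ((t * S z : ℝ) * Complex.I) with hφ
  have hre : ∑ z, w z * ((1 - t) * Real.cos (t * (S z - v)))
      = (1 - t) * (Complex.exp ((-(t * v) : ℝ) * Complex.I) * φ).re := by
    rw [hφ, Finset.mul_sum, Complex.re_sum, Finset.mul_sum]
    refine Finset.sum_congr rfl fun z _ => ?_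
    rw [mul_left_comm (Complex.exp _), ← Complex.exp_add, ← add_mul, ← Complex.ofReal_add,
      Complex.re_ofReal_mul, Complex.exp_ofReal_mul_I_re]
    ring_nf
  rw [hre]
  have hle : (Complex.exp ((-(t * v) : ℝ) * Complex.I) * φ).re ≤ ‖φ‖ := by
    refine (Complex.re_le_norm _).trans ?_
    rw [norm_mul, Complex.norm_exp_ofReal_mul_I, one_mul]
  calc _ ≤ (1 - t) * ‖φ‖ := mul_le_mul_of_nonneg_left hle (by linarith [ht.2])
    _ ≤ 1 * ‖φ‖ := mul_le_mul_of_nonneg_right (by linarith [ht.1]) (norm_nonneg _)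
    _ = ‖φ‖ := one_mul _

/-- The weight against which translates of `fejer` are averaged to dominate
`y ↦ exp (-y)` on the positive half-line. -/
def expWeight (a w : ℝ) : ℝ := Real.exp (-(max (w - 3) 0 / a))

theorem continuous_expWeight (a : ℝ) : Continuous (expWeight a) := by
  unfold expWeight
  fun_prop

theorem integral_expWeight_le {a W : ℝ} (ha : 0 < a) (hW : 3 ≤ W) :
    ∫ w in (-3 : ℝ)..W, expWeight a w ≤ 6 + a := by
  have hc := continuous_expWeight a
  rw [← intervalIntegral.integral_add_adjacent_intervals (hc.intervalIntegrable (-3) 3)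
    (hc.intervalIntegrable 3 W)]
  refine add_le_add ?_ ?_
  · have h := intervalIntegral.integral_mono_on (a := (-3 : ℝ)) (b := 3) (by norm_num)
      (hc.intervalIntegrable _ _)
      (intervalIntegrable_const (μ := MeasureTheory.volume) (c := (1 : ℝ))) fun w hw => by
        simp [expWeight, max_eq_right (show w - 3 ≤ 0 by linarith [hw.2])]
    refine h.trans ?_
    norm_num
  · have hd (w : ℝ) : HasDerivAt (fun w => -a * Real.exp (-((w - 3) / a)))
        (Real.exp (-((w - 3) / a))) w := by
      have h := ((((hasDerivAt_id' w).sub_const 3).div_const a).neg.exp).const_mul (-a)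
      refine h.congr_deriv ?_
      simp only [Pi.neg_apply]
      field_simp
    have h : ∫ w in (3 : ℝ)..W, expWeight a w = ∫ w in (3 : ℝ)..W, Real.exp (-((w - 3) / a)) := by
      refine intervalIntegral.integral_congr fun w hw => ?_
      rw [Set.uIcc_of_le hW] at hw
      simp [expWeight, max_eq_left (show 0 ≤ w - 3 by linarith [hw.1])]
    rw [h, intervalIntegral.integral_eq_sub_of_hasDerivAt (fun t _ => hd t)
      (Continuous.intervalIntegrable (by fun_prop) _ _)]
    have := mul_pos ha (Real.exp_pos (-((W - 3) / a)))
    simp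
    linarith

theorem exp_neg_mul_integral_fejer_le {a y W : ℝ} (ha : 0 < a) (hy : 0 < y) (hW : a * y + 3 ≤ W) :
    Real.exp (-y) * ∫ x in (-3 : ℝ)..3, fejer x
      ≤ ∫ w in (-3 : ℝ)..W, expWeight a w * fejer (a * y - w) := by
  have hay := mul_pos ha hy
  have hF := continuous_fejer
  have hM := continuous_expWeight a
  have hshift : ∫ x in (-3 : ℝ)..3, fejer x
      = ∫ w in (a * y - 3)..(a * y + 3), fejer (a * y - w) := by
    rw [intervalIntegral.integral_comp_sub_left]
    congr 1 <;> ring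
  rw [hshift, ← intervalIntegral.integral_const_mul]
  calc _ ≤ ∫ w in (a * y - 3)..(a * y + 3), expWeight a w * fejer (a * y - w) := by
        refine intervalIntegral.integral_mono_on (by linarith)
          (Continuous.intervalIntegrable (by fun_prop) _ _)
          (Continuous.intervalIntegrable (by fun_prop) _ _) fun w hw => ?_
        refine mul_le_mul_of_nonneg_right ?_ (fejer_nonneg _)
        refine Real.exp_le_exp.2 (neg_le_neg ?_)
        rw [div_le_iff₀ ha]
        exact max_le (by linarith [hw.2]) (by positivity)
    _ ≤ _ := by
        refine intervalIntegral.integral_mono_interval (by linarith) (by linarith) hW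
          (Filter.Eventually.of_forall fun w => mul_nonneg (Real.exp_nonneg _) (fejer_nonneg _))
          (Continuous.intervalIntegrable (by fun_prop) _ _)

/-- A bound on all `fejer`-smoothed point masses of a finite weighted sample bounds its one-sided
exponential moment. -/
theorem sum_exp_neg_le_of_sum_fejer_le {Ω : Type*} [Fintype Ω] {w S : Ω → ℝ} (hw : ∀ z, 0 ≤ w z)
    {a B : ℝ} (ha : 0 < a) (hB : ∀ v, ∑ z, w z * fejer (a * S z - v) ≤ B) :
    (∑ z, if 0 < S z then w z * Real.exp (-S z) else 0) * 2.369 ≤ (6 + a) * B := by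
  have hF := continuous_fejer
  have hM := continuous_expWeight a
  have hB0 : 0 ≤ B :=
    (Finset.sum_nonneg fun z _ => mul_nonneg (hw z) (fejer_nonneg _)).trans (hB 0)
  obtain ⟨W, hW3, hW⟩ : ∃ W : ℝ, 3 ≤ W ∧ ∀ z, a * S z + 3 ≤ W := by
    refine ⟨3 + ∑ z, |a * S z|, ?_, fun z => ?_⟩
    · linarith [Finset.sum_nonneg fun z (_ : z ∈ Finset.univ) => abs_nonneg (a * S z)]
    · have := Finset.single_le_sum (f := fun z => |a * S z|) (fun z _ => abs_nonneg _)
        (Finset.mem_univ z)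
      have h2 := le_abs_self (a * S z)
      linarith
  calc _ ≤ ∑ z, w z * ∫ u in (-3 : ℝ)..W, expWeight a u * fejer (a * S z - u) := by
        rw [Finset.sum_mul]
        refine Finset.sum_le_sum fun z _ => ?_
        split_ifs with h
        · rw [mul_assoc]
          refine mul_le_mul_of_nonneg_left (le_trans ?_
            (exp_neg_mul_integral_fejer_le ha h (hW z))) (hw z)
          exact mul_le_mul_of_nonneg_left integral_fejer_lower (Real.exp_nonneg _)
        · rw [zero_mul]
          exact mul_nonneg (hw z) (intervalIntegral.integral_nonneg (by linarith)
            fun u _ => mul_nonneg (Real.exp_nonneg _) (fejer_nonneg _))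
    _ = ∫ u in (-3 : ℝ)..W, expWeight a u * ∑ z, w z * fejer (a * S z - u) := by
        simp only [← intervalIntegral.integral_const_mul]
        rw [← intervalIntegral.integral_finsetSum (μ := MeasureTheory.volume)
          fun z _ => Continuous.intervalIntegrable (by fun_prop) _ _]
        refine intervalIntegral.integral_congr fun u _ => ?_
        simp only [Finset.mul_sum]
        exact Finset.sum_congr rfl fun z _ => by ring
    _ ≤ ∫ u in (-3 : ℝ)..W, expWeight a u * B := by
        refine intervalIntegral.integral_mono_on (by linarith)
          (Continuous.intervalIntegrable (by fun_prop) _ _)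
          (Continuous.intervalIntegrable (by fun_prop) _ _) fun u _ => ?_
        exact mul_le_mul_of_nonneg_left (hB u) (Real.exp_nonneg _)
    _ ≤ (6 + a) * B := by
        rw [intervalIntegral.integral_mul_const]
        exact mul_le_mul_of_nonneg_right (integral_expWeight_le ha hW3) hB0

theorem integral_exp_neg_mul_sq_le {b : ℝ} (hb : 0 < b) :
    ∫ t in (0 : ℝ)..1, Real.exp (-b * t ^ 2) ≤ √(Real.pi / b) / 2 := by
  rw [← integral_gaussian_Ioi, intervalIntegral.integral_of_le zero_le_one]
  exact MeasureTheory.setIntegral_mono_set (integrable_exp_neg_mul_sq hb).integrableOn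
    (Filter.Eventually.of_forall fun t => (Real.exp_nonneg _))
    (Filter.Eventually.of_forall fun t ht => ht.1)

/-- The characteristic function of a centred finite distribution near the origin. -/
theorem norm_sum_cexp_le {Ω : Type*} [Fintype Ω] {p X : Ω → ℝ} (hp : ∀ z, 0 ≤ p z)
    (hp1 : ∑ z, p z = 1) (hX : ∑ z, p z * X z = 0) {t : ℝ}
    (ht : t ^ 2 * ∑ z, p z * X z ^ 2 ≤ 2) :
    ‖∑ z, (p z : ℂ) * Complex.exp ((t * X z : ℝ) * Complex.I)‖
      ≤ 1 - t ^ 2 * (∑ z, p z * X z ^ 2) / 2 + |t| ^ 3 * (∑ z, p z * |X z| ^ 3) / 6 := by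
  have hsplit : ∑ z, (p z : ℂ) * Complex.exp ((t * X z : ℝ) * Complex.I)
      = ∑ z, (p z : ℂ) * (Complex.exp ((t * X z : ℝ) * Complex.I)
          - (1 + (t * X z : ℝ) * Complex.I - ((t * X z : ℝ) : ℂ) ^ 2 / 2))
        + ((1 - t ^ 2 * (∑ z, p z * X z ^ 2) / 2 : ℝ) : ℂ) := by
    have h1 : ∑ z, (p z : ℂ) = 1 := by exact_mod_cast hp1
    have h2 : ∑ z, (p z : ℂ) * X z = 0 := by exact_mod_cast hX
    have h3 : ∑ z, (p z : ℂ) * (1 + (t * X z : ℝ) * Complex.I - ((t * X z : ℝ) : ℂ) ^ 2 / 2)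
        = ∑ z, (p z : ℂ) + t * Complex.I * ∑ z, (p z : ℂ) * X z
          - t ^ 2 / 2 * ∑ z, (p z : ℂ) * (X z : ℂ) ^ 2 := by
      simp only [Finset.mul_sum, ← Finset.sum_add_distrib, ← Finset.sum_sub_distrib]
      refine Finset.sum_congr rfl fun z _ => ?_
      push_cast
      ring
    simp only [mul_sub (_ : ℂ) (Complex.exp _), Finset.sum_sub_distrib]
    rw [h3, h1, h2]
    push_cast
    ring
  rw [hsplit]
  refine (norm_add_le _ _).trans ?_
  rw [Complex.norm_real, Real.norm_eq_abs, abs_of_nonneg (by linarith), add_comm]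
  gcongr
  refine (norm_sum_le _ _).trans ?_
  rw [Finset.mul_sum, Finset.sum_div]
  refine Finset.sum_le_sum fun z _ => ?_
  rw [norm_mul, Complex.norm_real, Real.norm_eq_abs, abs_of_nonneg (hp z)]
  refine (mul_le_mul_of_nonneg_left (norm_cexp_mul_I_sub_taylor_le _) (hp z)).trans_eq ?_
  rw [abs_mul]
  ring

theorem sqrt_pow_three_le_sum_abs_pow_three {Ω : Type*} [Fintype Ω] {p X : Ω → ℝ}
    (hp : ∀ z, 0 ≤ p z) (hp1 : ∑ z, p z = 1) :
    √(∑ z, p z * X z ^ 2) ^ 3 ≤ ∑ z, p z * |X z| ^ 3 := by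
  set v := ∑ z, p z * X z ^ 2 with hv
  have hv0 : 0 ≤ v := Finset.sum_nonneg fun z _ => mul_nonneg (hp z) (sq_nonneg _)
  set s := √v
  have hs : 0 ≤ s := Real.sqrt_nonneg v
  have hsq : s ^ 2 = v := Real.sq_sqrt hv0
  have h : 3 * s * v ≤ 2 * ∑ z, p z * |X z| ^ 3 + s ^ 3 * ∑ z, p z := by
    rw [hv]
    simp only [Finset.mul_sum, ← Finset.sum_add_distrib]
    refine Finset.sum_le_sum fun z _ => ?_
    have hx := abs_nonneg (X z)
    have key : 3 * s * |X z| ^ 2 ≤ 2 * |X z| ^ 3 + s ^ 3 := by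
      nlinarith [mul_nonneg (add_nonneg (mul_nonneg zero_le_two hx) hs) (sq_nonneg (|X z| - s))]
    rw [sq_abs] at key
    nlinarith [mul_le_mul_of_nonneg_left key (hp z)]
  rw [hp1, ← hsq] at h
  nlinarith

theorem norm_sum_pi_cexp {Ω : Type*} [Fintype Ω] (p X : Ω → ℝ) (n : ℕ) (t c : ℝ) :
    ‖∑ f : Fin n → Ω, ((∏ i, p (f i) : ℝ) : ℂ)
        * Complex.exp ((t * (∑ i, X (f i) + c) : ℝ) * Complex.I)‖
      = ‖∑ z, (p z : ℂ) * Complex.exp ((t * X z : ℝ) * Complex.I)‖ ^ n := by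
  rw [← norm_pow, Fintype.sum_pow]
  have h : ∀ f : Fin n → Ω, ((∏ i, p (f i) : ℝ) : ℂ)
        * Complex.exp ((t * (∑ i, X (f i) + c) : ℝ) * Complex.I)
      = Complex.exp ((t * c : ℝ) * Complex.I)
        * ∏ i, (p (f i) : ℂ) * Complex.exp ((t * X (f i) : ℝ) * Complex.I) := fun f => by
    rw [Finset.prod_mul_distrib, ← Complex.exp_sum, ← Finset.sum_mul, ← Complex.ofReal_sum,
      ← Finset.mul_sum, mul_add, Complex.ofReal_add, add_mul, Complex.exp_add, Complex.ofReal_prod]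
    ring
  simp only [h]
  rw [← Finset.mul_sum, norm_mul, Complex.norm_exp_ofReal_mul_I, one_mul]

theorem fejer_constant_bound {a r : ℝ} (ha : 0 < a) (hr : 0 < r) :
    (6 + a) * (√(Real.pi / ((r * a) ^ 2 * (17 / 36))) / 2)
      ≤ 2 * (Real.log 2 / √(2 * Real.pi) + 2 / a) / r * 2.369 := by
  have hpi := Real.pi_pos
  have hpi2 := Real.pi_lt_d4
  have hlog := Real.log_two_gt_d9
  have hq0 : 0 < √Real.pi := Real.sqrt_pos.2 hpi
  have hqq : √Real.pi ^ 2 = Real.pi := Real.sq_sqrt hpi.le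
  have hq : √Real.pi ≤ 1.78 := by
    rw [Real.sqrt_le_left (by norm_num)]; norm_num; linarith
  have h2 : √2 ≤ 1.4143 := by
    rw [Real.sqrt_le_left (by norm_num)]; norm_num
  have h20 : 0 < √2 := by positivity
  have h17 : 4.123 ≤ √17 := Real.le_sqrt_of_sq_le (by norm_num)
  have h17' : 0 < √17 := by positivity
  have e36 : √36 = 6 := by
    rw [show (36 : ℝ) = 6 ^ 2 by norm_num]
    exact Real.sqrt_sq (by norm_num)
  rw [Real.sqrt_div hpi.le, Real.sqrt_mul (sq_nonneg _), Real.sqrt_sq (by positivity),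
    Real.sqrt_div (by norm_num), e36, Real.sqrt_mul zero_le_two]
  set q := √Real.pi
  set K := 3 * q / √17 with hK
  have hK1 : K ≤ 2.369 * (2 * (Real.log 2 / (√2 * q))) := by
    rw [hK, ← mul_div_assoc, ← mul_div_assoc, div_le_div_iff₀ h17' (by positivity)]
    have e : 3 * q * (√2 * q) = 3 * √2 * Real.pi := by rw [← hqq]; ring
    rw [e]
    have h3 : √2 * Real.pi ≤ 1.4143 * 3.1416 := mul_le_mul h2 hpi2.le hpi.le (by norm_num)
    have h4 : (0.6931 : ℝ) * 4.123 ≤ Real.log 2 * √17 :=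
      mul_le_mul (by linarith) h17 (by norm_num) (by linarith)
    linarith
  have hK2 : K ≤ 1.5 := by
    rw [hK, div_le_iff₀ h17']
    linarith
  have e1 : (6 + a) * (q / (r * a * (√17 / 6)) / 2) = (6 + a) * K / (r * a) := by
    rw [hK]
    field_simp
    ring
  have e2 : 2 * (Real.log 2 / (√2 * q) + 2 / a) / r * 2.369
      = (a * (2.369 * (2 * (Real.log 2 / (√2 * q)))) + 9.476) / (r * a) := by
    field_simp
    ring
  rw [e1, e2]
  refine div_le_div_of_nonneg_right ?_ (by positivity)
  nlinarith [mul_le_mul_of_nonneg_left hK1 ha.le]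

theorem sum_pi_exp_neg_le {Ω : Type*} [Fintype Ω] {p j : Ω → ℝ} (hp : ∀ z, 0 ≤ p z)
    (hp1 : ∑ z, p z = 1) {μ v T : ℝ} (hμ : μ = ∑ z, p z * j z)
    (hv : v = ∑ z, p z * (j z - μ) ^ 2) (hT : T = ∑ z, p z * |j z - μ| ^ 3)
    (hvpos : 0 < v) {n : ℕ} (hn : 1 ≤ n) (A : ℝ) :
    (∑ f : Fin n → Ω, if 0 < ∑ i, j (f i) - A then
        (∏ i, p (f i)) * Real.exp (-(∑ i, j (f i) - A)) else 0)
      ≤ 2 * (Real.log 2 / √(2 * Real.pi) + 12 * T / v) / (√v * √n) := by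
  have hX : ∑ z, p z * (j z - μ) = 0 := by
    simp only [mul_sub, Finset.sum_sub_distrib, ← Finset.sum_mul, hp1, ← hμ]
    ring
  have hs : 0 < √v := Real.sqrt_pos.2 hvpos
  have hvT : √v ^ 3 ≤ T := by
    rw [hv, hT]
    exact sqrt_pow_three_le_sum_abs_pow_three hp hp1
  have hTpos : 0 < T := (pow_pos hs 3).trans_le hvT
  have hn0 : (0 : ℝ) < n := by exact_mod_cast hn
  set a := v / (6 * T) with ha
  have hapos : 0 < a := by positivity
  have haT : a * T = v / 6 := by rw [ha]; field_simp
  have hav : a ^ 2 * v ≤ 2 := by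
    have h1 : √v ^ 2 = v := Real.sq_sqrt hvpos.le
    have h2 : a * √v ≤ 1 := by
      rw [ha, div_mul_eq_mul_div, div_le_one (by positivity)]
      calc v * √v = √v ^ 3 := by rw [pow_succ, h1]
        _ ≤ 6 * T := by linarith
    calc a ^ 2 * v = (a * √v) ^ 2 := by rw [mul_pow, h1]
      _ ≤ 1 ^ 2 := pow_le_pow_left₀ (by positivity) h2 2
      _ ≤ 2 := by norm_num
  have hchar : ∀ t ∈ Set.Icc (0 : ℝ) 1,
      ‖∑ z, (p z : ℂ) * Complex.exp ((t * a * (j z - μ) : ℝ) * Complex.I)‖ ^ n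
        ≤ Real.exp (-((√v * √n * a) ^ 2 * (17 / 36)) * t ^ 2) := fun t ht => by
    have hta : 0 ≤ t * a := mul_nonneg ht.1 hapos.le
    have hta' : t * a ≤ a := mul_le_of_le_one_left hapos.le ht.2
    have h := norm_sum_cexp_le hp hp1 hX (t := t * a) (by
      rw [← hv]
      refine le_trans ?_ hav
      gcongr)
    rw [← hv, ← hT, abs_of_nonneg hta] at h
    have h3 : (t * a) ^ 3 * T ≤ (t * a) ^ 2 * (v / 6) := by
      rw [pow_succ, mul_assoc, ← haT]
      gcongr
    have h4 : ‖∑ z, (p z : ℂ) * Complex.exp ((t * a * (j z - μ) : ℝ) * Complex.I)‖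
        ≤ Real.exp (-((t * a) ^ 2 * v * (17 / 36))) := by
      refine h.trans (le_trans ?_ (Real.add_one_le_exp _))
      linarith
    refine (pow_le_pow_left₀ (norm_nonneg _) h4 n).trans_eq ?_
    rw [← Real.exp_nat_mul]
    congr 1
    rw [mul_pow (√v * √n), mul_pow (√v), Real.sq_sqrt hvpos.le, Real.sq_sqrt hn0.le]
    ring
  have hB : ∀ x, ∑ f : Fin n → Ω, (∏ i, p (f i)) * fejer (a * (∑ i, j (f i) - A) - x)
      ≤ √(Real.pi / ((√v * √n * a) ^ 2 * (17 / 36))) / 2 := fun x => by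
    refine (sum_mul_fejer_le (fun f : Fin n → Ω => ∏ i, p (f i))
      (fun f => a * (∑ i, j (f i) - A)) x).trans ?_
    refine le_trans ?_ (integral_exp_neg_mul_sq_le (by positivity))
    refine intervalIntegral.integral_mono_on zero_le_one
      (Continuous.intervalIntegrable (by fun_prop) 0 1)
      (Continuous.intervalIntegrable (by fun_prop) 0 1) fun t ht => ?_
    refine le_trans (le_of_eq ?_) (hchar t ht)
    rw [← norm_sum_pi_cexp p (fun z => j z - μ) n (t * a) (n * μ - A)]
    congr 1
    refine Finset.sum_congr rfl fun f _ => ?_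
    congr 4
    simp only [Finset.sum_sub_distrib, Finset.sum_const, Finset.card_univ, Fintype.card_fin,
      nsmul_eq_mul]
    ring
  have hmain := (sum_exp_neg_le_of_sum_fejer_le
    (fun f : Fin n → Ω => Finset.prod_nonneg fun i _ => hp (f i)) hapos hB).trans
    (fejer_constant_bound hapos (by positivity))
  have e : 12 * T / v = 2 / a := by
    rw [ha]
    field_simp
    norm_num
  rw [e]
  exact le_of_mul_le_mul_right hmain (by norm_num)

theorem sub_le_mul_log_div {p q : ℝ} (hp : 0 ≤ p) (hq : 0 < q) :
    p - q ≤ p * Real.log (p / q) := by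
  rcases hp.eq_or_lt with rfl | hp
  · simpa using hq.le
  · have h := Real.add_one_le_exp (-Real.log (p / q))
    rw [Real.exp_neg, Real.exp_log (by positivity), inv_div] at h
    have h2 := mul_le_mul_of_nonneg_left h hp.le
    rw [mul_div_cancel₀ _ hp.ne'] at h2
    linarith

theorem relEnt_nonneg_s10 {P Q : X × Y → ℝ} (hP : IsDist P) (hQ : IsPos Q) : 0 ≤ relEnt P Q := by
  have h := Finset.sum_le_sum fun z (_ : z ∈ Finset.univ) =>
    sub_le_mul_log_div (hP.1 z) (hQ.1 z)
  rwa [Finset.sum_sub_distrib, hP.2, hQ.2, sub_self] at h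

theorem projE_le_relEnt_s10 {P P' Q : X × Y → ℝ} (hQ : IsPos Q) (hP' : IsDist P')
    (hX : margX P' = margX P) (hY : margY P' = margY P) : projE P Q ≤ relEnt P' Q := by
  refine csInf_le ⟨0, ?_⟩ ⟨P', hP', hX, hY, rfl⟩
  rintro _ ⟨R, hR, -, -, rfl⟩
  exact relEnt_nonneg_s10 hR hQ

theorem mul_log_div_convex {p r q ε : ℝ} (hp : 0 ≤ p) (hr : 0 < r) (hq : 0 < q) (hε : 0 < ε)
    (hε1 : ε < 1) :
    ((1 - ε) * p + ε * r) * Real.log (((1 - ε) * p + ε * r) / q)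
      ≤ (1 - ε) * (p * Real.log (p / q)) + ε * (r * Real.log (r / q)) := by
  have h := Real.convexOn_mul_log.2 (x := p / q) (y := r / q) (div_nonneg hp hq.le)
    (div_nonneg hr.le hq.le) (sub_nonneg.2 hε1.le) hε.le (sub_add_cancel 1 ε)
  simp only [smul_eq_mul] at h
  have e : (1 - ε) * (p / q) + ε * (r / q) = ((1 - ε) * p + ε * r) / q := by ring
  rw [e] at h
  have h2 := mul_le_mul_of_nonneg_left h hq.le
  refine (le_of_eq ?_).trans (h2.trans_eq ?_) <;> field_simp

/-- A minimiser of the relative entropy with positive prescribed marginals is positive. -/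
theorem pos_of_relEnt_eq_projE {P Q Ps : X × Y → ℝ} (hP : IsPos P) (hQ : IsPos Q)
    (hPs : IsDist Ps) (hPsX : margX Ps = margX P) (hPsY : margY Ps = margY P)
    (hmin : relEnt Ps Q = projE P Q) (z : X × Y) : 0 < Ps z := by
  by_contra hz
  have hz0 : Ps z = 0 := le_antisymm (not_lt.1 hz) (hPs.1 z)
  have hle : relEnt Ps Q ≤ relEnt P Q :=
    hmin ▸ projE_le_relEnt_s10 hQ ⟨fun z => (hP.1 z).le, hP.2⟩ rfl rfl
  have hPz := hP.1 z
  set ε := Real.exp (-((relEnt P Q - relEnt Ps Q + 1) / P z)) with hε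
  have hεpos : 0 < ε := Real.exp_pos _
  have hε1 : ε < 1 := Real.exp_lt_one_iff.2 (neg_neg_of_pos (div_pos (by linarith) hPz))
  let R : X × Y → ℝ := fun z => (1 - ε) * Ps z + ε * P z
  have hR : IsDist R := by
    refine ⟨fun z => add_nonneg (mul_nonneg (by linarith) (hPs.1 z))
      (mul_nonneg hεpos.le (hP.1 z).le), ?_⟩
    simp only [R, Finset.sum_add_distrib, ← Finset.mul_sum, hPs.2, hP.2]
    ring
  have hRX : margX R = margX P := by
    funext x
    have h := congrFun hPsX x
    simp only [margX] at h ⊢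
    simp only [R, Finset.sum_add_distrib, ← Finset.mul_sum, h]
    ring
  have hRY : margY R = margY P := by
    funext y
    have h := congrFun hPsY y
    simp only [margY] at h ⊢
    simp only [R, Finset.sum_add_distrib, ← Finset.mul_sum, h]
    ring
  have hmin' : relEnt Ps Q ≤ relEnt R Q := hmin ▸ projE_le_relEnt_s10 hQ hR hRX hRY
  have hup : relEnt R Q
      ≤ (1 - ε) * relEnt Ps Q + ε * relEnt P Q + ε * P z * Real.log ε := by
    simp only [relEnt, Finset.mul_sum, ← Finset.sum_add_distrib]
    rw [← Finset.add_sum_erase _ _ (Finset.mem_univ z),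
      ← Finset.add_sum_erase _ _ (Finset.mem_univ z), add_right_comm]
    refine add_le_add (le_of_eq ?_) (Finset.sum_le_sum fun z _ =>
      mul_log_div_convex (hPs.1 z) (hP.1 z) (hQ.1 z) hεpos hε1)
    have hQz := hQ.1 z
    simp only [R, hz0, mul_zero, zero_add, zero_mul]
    rw [mul_div_assoc, Real.log_mul hεpos.ne' (by positivity)]
    ring
  have hlog : P z * Real.log ε = -(relEnt P Q - relEnt Ps Q + 1) := by
    rw [hε, Real.log_exp]
    field_simp
  have hcontra : ε * P z * Real.log ε = -(ε * (relEnt P Q - relEnt Ps Q + 1)) := by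
    rw [mul_assoc, hlog]
    ring
  nlinarith

/-- non-asymptotic bound on the type II error probability of the test
based on the projected relative entropy density. -/
theorem type_two_error_nonasymptotic_bound
    [Nonempty X] [Nonempty Y]
    (P Q Ps : X × Y → ℝ) (hP : IsPos P) (hQ : IsPos Q)
    (hPs : IsDist Ps) (hPsX : margX Ps = margX P) (hPsY : margY Ps = margY P)
    (hmin : relEnt Ps Q = projE P Q)
    (j : X × Y → ℝ) (hj : ∀ z : X × Y, j z = Real.log (Ps z / Q z))
    (σ2 T : ℝ)
    (hσ2 : σ2 = ∑ z : X × Y, Ps z * (j z - relEnt Ps Q) ^ 2)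
    (hT : T = ∑ z : X × Y, Ps z * |j z - relEnt Ps Q| ^ 3)
    (hσpos : 0 < σ2)
    (n : ℕ) (hn : 1 ≤ n) (τ : ℝ) :
    prodProb Q n
        {z : (Fin n → X) × (Fin n → Y) |
          (1 / (n : ℝ)) * ∑ i : Fin n, j (z.1 i, z.2 i) > τ}
      ≤ 2 * (Real.log 2 / Real.sqrt (2 * Real.pi) + 12 * T / σ2)
          * Real.exp (-(n : ℝ) * τ) / (Real.sqrt σ2 * Real.sqrt (n : ℝ)) := by
  have hpos := pos_of_relEnt_eq_projE hP hQ hPs hPsX hPsY hmin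
  have hn0 : (0 : ℝ) < n := by exact_mod_cast hn
  have hcore := sum_pi_exp_neg_le hPs.1 hPs.2 (μ := relEnt Ps Q) (j := j)
    (by simp only [relEnt, hj]) hσ2 hT hσpos hn (n * τ)
  have hQe (z : X × Y) : Q z = Ps z * Real.exp (-j z) := by
    rw [hj, Real.exp_neg, Real.exp_log (div_pos (hpos z) (hQ.1 z)), inv_div,
      mul_div_cancel₀ _ (hpos z).ne']
  have hsum : prodProb Q n {z : (Fin n → X) × (Fin n → Y) |
        (1 / (n : ℝ)) * ∑ i : Fin n, j (z.1 i, z.2 i) > τ}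
      = Real.exp (-(n : ℝ) * τ) * ∑ f : Fin n → X × Y,
          if 0 < ∑ i, j (f i) - n * τ then
            (∏ i, Ps (f i)) * Real.exp (-(∑ i, j (f i) - n * τ)) else 0 := by
    rw [prodProb, Finset.mul_sum, ← (Equiv.arrowProdEquivProdArrow (Fin n) (fun _ => X)
      (fun _ => Y)).sum_comp]
    refine Finset.sum_congr rfl fun f _ => ?_
    have hiff : (1 / (n : ℝ)) * ∑ i, j (f i) > τ ↔ 0 < ∑ i, j (f i) - n * τ := by
      rw [gt_iff_lt, one_div_mul_eq_div, lt_div_iff₀ hn0, sub_pos, mul_comm]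
    simp only [Set.mem_ofPred_eq, Equiv.arrowProdEquivProdArrow, Equiv.coe_fn_mk, Prod.mk.eta, hiff]
    split_ifs
    · simp only [hQe, Finset.prod_mul_distrib, ← Real.exp_sum, Finset.sum_neg_distrib]
      rw [mul_left_comm, ← Real.exp_add]
      ring_nf
    · simp
  rw [hsum]
  refine (mul_le_mul_of_nonneg_left hcore (Real.exp_nonneg _)).trans_eq ?_
  ring
end
end
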